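/- arXiv:math/0412526 — 3 statements merged into one kernel-verified Lean document; each statement's English description precedes it below -/
import Mathlib

section
/- Let p, q ≥ 0 with p + q ≤ r and let a ∈ C_{p,q}. Then the tangent cone of the set C_{p,q} at the point a, taken inside the real normed space Herm(r), equals the real linear subspace {w ∈ Herm(r) : ⟨x, w y⟩ = 0 for all x, y ∈ ℂ^r with a x = 0 and a y = 0}, where ⟨·,·⟩ denotes the standard Hermitian inner product on ℂ^r. -/
open Matrix

/-- `Cpq r p q` is the set of Hermitian `r × r` complex matrices having exactly `p`
positive and exactly `q` negative eigenvalues, counted with multiplicity. -/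
def Cpq (r p q : ℕ) : Set (Matrix (Fin r) (Fin r) ℂ) :=
  {x | ∃ hx : x.IsHermitian,
    (Finset.univ.filter fun i => 0 < hx.eigenvalues i).card = p ∧
    (Finset.univ.filter fun i => hx.eigenvalues i < 0).card = q}

open Filter Topology

/-- Spectral decomposition with plain matrix products. -/
lemma spec_decomp {r : ℕ} {x : Matrix (Fin r) (Fin r) ℂ} (hx : x.IsHermitian) :
    ∃ U : Matrix (Fin r) (Fin r) ℂ, Uᴴ * U = 1 ∧ U * Uᴴ = 1 ∧
      x = U * diagonal (fun i => (hx.eigenvalues i : ℂ)) * Uᴴ := by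
  refine ⟨hx.eigenvectorUnitary, ?_, ?_, ?_⟩
  · exact Unitary.coe_star_mul_self _
  · exact Unitary.coe_mul_star_self _
  · conv_lhs => rw [hx.spectral_theorem, Unitary.conjStarAlgAut_apply]
    rfl

lemma quad_diag {r : ℕ} (l : Fin r → ℝ) (u : Fin r → ℂ) :
    star u ⬝ᵥ (diagonal (fun i => (l i : ℂ))) *ᵥ u = ((∑ i, l i * ‖u i‖ ^ 2 : ℝ) : ℂ) := by
  simp only [dotProduct, mulVec_diagonal, Pi.star_apply]
  push_cast
  refine Finset.sum_congr rfl fun i _ => ?_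
  rw [← Complex.conj_mul' (u i)]
  simp only [RCLike.star_def]
  ring

/-- The core of Sylvester's law of inertia. -/
lemma inertia_le {r : ℕ} (l m : Fin r → ℝ) (S : Matrix (Fin r) (Fin r) ℂ)
    (h : diagonal (fun i => (l i : ℂ)) = Sᴴ * diagonal (fun i => (m i : ℂ)) * S) :
    (Finset.univ.filter fun i => 0 < l i).card ≤ (Finset.univ.filter fun i => 0 < m i).card := by
  by_contra hlt
  push Not at hlt
  let ext : ({i // 0 < l i} → ℂ) →ₗ[ℂ] (Fin r → ℂ) :=
    { toFun := fun v i => if hi : 0 < l i then v ⟨i, hi⟩ else 0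
      map_add' := by intro v w; ext i; by_cases hi : 0 < l i <;> simp [hi]
      map_smul' := by intro c v; ext i; by_cases hi : 0 < l i <;> simp [hi] }
  let f : ({i // 0 < l i} → ℂ) →ₗ[ℂ] ({j // 0 < m j} → ℂ) :=
    (LinearMap.funLeft ℂ ℂ (Subtype.val : {j // 0 < m j} → Fin r)) ∘ₗ S.mulVecLin ∘ₗ ext
  have hker : LinearMap.ker f ≠ ⊥ := by
    apply LinearMap.ker_ne_bot_of_finrank_lt
    simpa [Fintype.card_subtype] using hlt
  obtain ⟨v, hv, hv0⟩ := Submodule.exists_mem_ne_zero_of_ne_bot hker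
  have hSu : ∀ j, 0 < m j → (S *ᵥ ext v) j = 0 := by
    intro j hj
    exact congrFun (LinearMap.mem_ker.mp hv) ⟨j, hj⟩
  have e : (∑ i, l i * ‖ext v i‖ ^ 2 : ℝ) = ∑ i, m i * ‖(S *ᵥ ext v) i‖ ^ 2 := by
    have h1 := quad_diag l (ext v)
    have h2 := quad_diag m (S *ᵥ ext v)
    rw [h, ← mulVec_mulVec, ← mulVec_mulVec, dotProduct_mulVec, ← star_mulVec, h2] at h1
    exact_mod_cast h1.symm
  have neg : ∑ i, m i * ‖(S *ᵥ ext v) i‖ ^ 2 ≤ 0 := by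
    refine Finset.sum_nonpos fun i _ => ?_
    by_cases hi : 0 < m i
    · simp [hSu i hi]
    · exact mul_nonpos_of_nonpos_of_nonneg (not_lt.mp hi) (by positivity)
  obtain ⟨⟨i, hi⟩, hvi⟩ := Function.ne_iff.mp hv0
  have pos : 0 < ∑ i, l i * ‖ext v i‖ ^ 2 := by
    refine Finset.sum_pos' (fun j _ => ?_) ⟨i, Finset.mem_univ _, ?_⟩
    · by_cases hj : 0 < l j
      · positivity
      · simp [ext, hj]
    · have : ext v i = v ⟨i, hi⟩ := by simp [ext, hi]
      rw [this]
      have : 0 < ‖v ⟨i, hi⟩‖ := norm_pos_iff.mpr hvi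
      positivity
  linarith

lemma inertia_congr {r : ℕ} {x y S : Matrix (Fin r) (Fin r) ℂ} (hx : x.IsHermitian)
    (hy : y.IsHermitian) (h : x = S * y * Sᴴ) :
    (Finset.univ.filter fun i => 0 < hx.eigenvalues i).card ≤
      (Finset.univ.filter fun i => 0 < hy.eigenvalues i).card ∧
    (Finset.univ.filter fun i => hx.eigenvalues i < 0).card ≤
      (Finset.univ.filter fun i => hy.eigenvalues i < 0).card := by
  obtain ⟨U, hU1, hU2, hU⟩ := spec_decomp hx
  obtain ⟨V, hV1, hV2, hV⟩ := spec_decomp hy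
  have key : diagonal (fun i => (hx.eigenvalues i : ℂ)) =
      (Vᴴ * Sᴴ * U)ᴴ * diagonal (fun i => (hy.eigenvalues i : ℂ)) * (Vᴴ * Sᴴ * U) := by
    have : diagonal (fun i => (hx.eigenvalues i : ℂ)) = Uᴴ * x * U := by
      conv_rhs => rw [hU]
      simp only [Matrix.mul_assoc, hU1, Matrix.mul_one]
      rw [← Matrix.mul_assoc, hU1, Matrix.one_mul]
    rw [this, h]
    conv_lhs => rw [hV]
    simp only [conjTranspose_mul, conjTranspose_conjTranspose, Matrix.mul_assoc]
  refine ⟨inertia_le _ _ _ key, ?_⟩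
  have := inertia_le (fun i => - hx.eigenvalues i) (fun i => - hy.eigenvalues i) (Vᴴ * Sᴴ * U) (by
    have e : ∀ l : Fin r → ℝ, diagonal (fun i => ((- l i : ℝ) : ℂ)) =
        - diagonal (fun i => (l i : ℂ)) := by
      intro l
      rw [diagonal_neg]
      congr 1
      ext i
      simp
    rw [e, e, key, Matrix.mul_neg, Matrix.neg_mul])
  simpa using this

lemma Cpq_congr {r p q : ℕ} {x S : Matrix (Fin r) (Fin r) ℂ} (hx : x ∈ Cpq r p q)
    (hS : IsUnit S.det) : S * x * Sᴴ ∈ Cpq r p q := by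
  obtain ⟨hx, rfl, rfl⟩ := hx
  have hy : (S * x * Sᴴ).IsHermitian := isHermitian_mul_mul_conjTranspose S hx
  have h1 := inertia_congr hy hx rfl
  have h2 := inertia_congr (S := S⁻¹) hx hy (by
    have e : Sᴴ * S⁻¹ᴴ = 1 := by
      rw [← conjTranspose_mul, nonsing_inv_mul _ hS, conjTranspose_one]
    simp only [Matrix.mul_assoc, e, Matrix.mul_one]
    rw [← Matrix.mul_assoc, nonsing_inv_mul _ hS, Matrix.one_mul])
  exact ⟨hy, le_antisymm h1.1 h2.1, le_antisymm h1.2 h2.2⟩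

lemma Cpq_rank {r p q : ℕ} {x : Matrix (Fin r) (Fin r) ℂ} (hx : x ∈ Cpq r p q) :
    x.rank = p + q := by
  obtain ⟨hx, rfl, rfl⟩ := hx
  rw [hx.rank_eq_card_non_zero_eigs, Fintype.card_subtype, ← Finset.card_union_of_disjoint]
  · congr 1
    ext i
    simp only [Finset.mem_filter, Finset.mem_univ, true_and, Finset.mem_union]
    rw [ne_iff_lt_or_gt, or_comm]
  · rw [Finset.disjoint_filter]
    intro i _ h1 h2
    exact lt_asymm h1 h2

/-- Pseudo-inverse `b` and kernel projection `P` of a Hermitian matrix. -/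
lemma exists_pinv {r : ℕ} {a : Matrix (Fin r) (Fin r) ℂ} (ha : a.IsHermitian) :
    ∃ b P : Matrix (Fin r) (Fin r) ℂ, bᴴ = b ∧ Pᴴ = P ∧ a * b = 1 - P ∧ b * a = 1 - P ∧
      a * P = 0 ∧ P * b = 0 ∧ P * P = P := by
  obtain ⟨U, hU1, hU2, hU⟩ := spec_decomp ha
  set l := ha.eigenvalues
  have mulU : ∀ d e : Fin r → ℂ, (U * diagonal d * Uᴴ) * (U * diagonal e * Uᴴ) =
      U * diagonal (fun i => d i * e i) * Uᴴ := by
    intro d e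
    rw [← diagonal_mul_diagonal]
    calc _ = U * diagonal d * (Uᴴ * U) * diagonal e * Uᴴ := by simp only [Matrix.mul_assoc]
      _ = _ := by rw [hU1]; simp only [Matrix.mul_assoc, Matrix.mul_one, Matrix.one_mul]
  have one_sub : ∀ d : Fin r → ℂ, 1 - U * diagonal d * Uᴴ =
      U * diagonal (fun i => 1 - d i) * Uᴴ := by
    intro d
    rw [← diagonal_sub, Matrix.mul_sub, Matrix.sub_mul]
    rw [show diagonal (fun _ : Fin r => (1 : ℂ)) = 1 from diagonal_one, Matrix.mul_one, hU2]
  refine ⟨U * diagonal (fun i => ((l i : ℂ))⁻¹) * Uᴴ,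
    U * diagonal (fun i => if l i = 0 then 1 else 0) * Uᴴ, ?_, ?_, ?_, ?_, ?_, ?_, ?_⟩
  · simp only [conjTranspose_mul, conjTranspose_conjTranspose, diagonal_conjTranspose,
      Matrix.mul_assoc]
    congr 3
    ext i
    simp
  · simp only [conjTranspose_mul, conjTranspose_conjTranspose, diagonal_conjTranspose,
      Matrix.mul_assoc]
    congr 3
    ext i
    by_cases h : l i = 0 <;> simp [h]
  · rw [hU, mulU, one_sub]
    congr 3
    ext i
    by_cases h : l i = 0 <;> simp [h]
  · rw [hU, mulU, one_sub]
    congr 3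
    ext i
    by_cases h : l i = 0 <;> simp [h]
  · rw [hU, mulU]
    rw [show (fun i => (l i : ℂ) * if l i = 0 then 1 else 0) = fun _ => 0 by
      ext i; by_cases h : l i = 0 <;> simp [h]]
    simp
  · rw [mulU]
    rw [show (fun i => (if l i = 0 then (1 : ℂ) else 0) * (l i : ℂ)⁻¹) = fun _ => 0 by
      ext i; by_cases h : l i = 0 <;> simp [h]]
    simp
  · rw [mulU]
    congr 3
    ext i
    by_cases h : l i = 0 <;> simp [h]

lemma rank_add_le_of_mul_eq_zero {r : ℕ} {a P : Matrix (Fin r) (Fin r) ℂ} (h : a * P = 0) :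
    a.rank + P.rank ≤ r := by
  have h1 : LinearMap.range P.mulVecLin ≤ LinearMap.ker a.mulVecLin := by
    rintro _ ⟨v, rfl⟩
    simp [h]
  have h2 := LinearMap.finrank_range_add_finrank_ker a.mulVecLin
  have h3 := Submodule.finrank_mono h1
  rw [Module.finrank_fin_fun] at h2
  unfold Matrix.rank
  omega

/-- If `m + P` is invertible and ranks add up, then `P T⁻¹ P = P`, `T = m + P`. -/
lemma rank_key {r : ℕ} {m P T : Matrix (Fin r) (Fin r) ℂ} (hT : T = m + P)
    (hu : IsUnit T.det) (hr : m.rank + P.rank ≤ r) : P * T⁻¹ * P = P := by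
  set A := LinearMap.range m.mulVecLin
  set B := LinearMap.range P.mulVecLin
  have hsup : A ⊔ B = ⊤ := by
    rw [eq_top_iff]
    intro v _
    have : v = m *ᵥ (T⁻¹ *ᵥ v) + P *ᵥ (T⁻¹ *ᵥ v) := by
      rw [← add_mulVec, ← hT, mulVec_mulVec, mul_nonsing_inv _ hu, one_mulVec]
    rw [this]
    exact Submodule.add_mem_sup ⟨_, rfl⟩ ⟨_, rfl⟩
  have hdim := Submodule.finrank_sup_add_finrank_inf_eq A B
  rw [hsup, finrank_top, Module.finrank_fin_fun] at hdim
  have hinf : A ⊓ B = ⊥ := by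
    apply Submodule.finrank_eq_zero.mp
    have hA : Module.finrank ℂ A = m.rank := rfl
    have hB : Module.finrank ℂ B = P.rank := rfl
    omega
  have e : m * T⁻¹ * P = P - P * T⁻¹ * P := by
    have : m = T - P := by rw [hT]; abel
    rw [this, Matrix.sub_mul, Matrix.sub_mul, mul_nonsing_inv _ hu, Matrix.one_mul]
  have z : m * T⁻¹ * P = 0 := by
    apply Matrix.mulVec_injective
    ext1 v
    rw [zero_mulVec, ← Submodule.mem_bot ℂ, ← hinf]
    refine ⟨⟨T⁻¹ *ᵥ P *ᵥ v, by simp [Matrix.mul_assoc]⟩,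
      ⟨v - T⁻¹ *ᵥ P *ᵥ v, ?_⟩⟩
    rw [e]
    simp [Matrix.sub_mulVec, Matrix.mulVec_sub, Matrix.mul_assoc]
  rw [z] at e
  exact (sub_eq_zero.mp e.symm).symm

/-- The polynomial relation satisfied by equal-rank perturbations. -/
lemma rank_key' {r : ℕ} {a b P d : Matrix (Fin r) (Fin r) ℂ}
    (hab : a * b = 1 - P) (haP : a * P = 0) (hPb : P * b = 0) (hPP : P * P = P)
    (hu : IsUnit (a + d + P).det) (hr : (a + d).rank ≤ a.rank) :
    P * (a + d + P).adjugate * d * P = 0 := by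
  have h1 := rank_key (m := a + d) (P := P) rfl hu
    ((Nat.add_le_add_right hr _).trans (rank_add_le_of_mul_eq_zero haP))
  set T := a + d + P with hT
  have h2 : T * P = P + d * P := by
    rw [hT]; simp only [Matrix.add_mul, haP, hPP]; abel
  have h3 : P = T⁻¹ * P + T⁻¹ * (d * P) := by
    rw [← Matrix.mul_add, ← h2, ← Matrix.mul_assoc, nonsing_inv_mul _ hu, Matrix.one_mul]
  have h4 : P * T⁻¹ * d * P = 0 := by
    have := congrArg (fun M => P * M) h3
    simp only [Matrix.mul_add, ← Matrix.mul_assoc, h1, hPP] at this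
    simpa using this
  have h5 : T.adjugate = T.det • T⁻¹ := by
    rw [inv_def, smul_smul, Ring.mul_inverse_cancel _ hu, one_smul]
  rw [h5]
  simp [h4]

open scoped ComplexOrder in
lemma proj_iff {r : ℕ} {a b P w : Matrix (Fin r) (Fin r) ℂ} (hP : Pᴴ = P)
    (hba : b * a = 1 - P) (haP : a * P = 0) :
    (∀ x y : Fin r → ℂ, a.mulVec x = 0 → a.mulVec y = 0 → star x ⬝ᵥ w.mulVec y = 0) ↔
      P * w * P = 0 := by
  have key : ∀ x y : Fin r → ℂ, star (P *ᵥ x) ⬝ᵥ w *ᵥ (P *ᵥ y) = star x ⬝ᵥ (P * w * P) *ᵥ y := by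
    intro x y
    rw [star_mulVec, hP, ← dotProduct_mulVec]
    simp [Matrix.mul_assoc]
  have fixed : ∀ x, a *ᵥ x = 0 → P *ᵥ x = x := by
    intro x hx
    have : P = 1 - b * a := by rw [hba]; abel
    rw [this, sub_mulVec, one_mulVec, ← mulVec_mulVec, hx, mulVec_zero, sub_zero]
  constructor
  · intro h
    apply Matrix.mulVec_injective
    ext1 y
    rw [zero_mulVec]
    apply dotProduct_star_self_eq_zero.mp
    rw [← key]
    exact h _ _ (by rw [mulVec_mulVec, haP, zero_mulVec]) (by rw [mulVec_mulVec, haP, zero_mulVec])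
  · intro h x y hx hy
    rw [← fixed x hx, ← fixed y hy, key, h]
    simp

lemma exists_gen {r : ℕ} {a b P w : Matrix (Fin r) (Fin r) ℂ} (ha : aᴴ = a)
    (hP : Pᴴ = P) (hba : b * a = 1 - P) (hw : wᴴ = w) (h : P * w * P = 0) :
    ∃ g : Matrix (Fin r) (Fin r) ℂ, g * a + a * gᴴ = w := by
  refine ⟨w * b - (1 / 2 : ℂ) • ((1 - P) * w * b), ?_⟩
  set g := w * b - (1 / 2 : ℂ) • ((1 - P) * w * b) with hg
  have h1 : g * a = w * (1 - P) - (1 / 2 : ℂ) • ((1 - P) * w * (1 - P)) := by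
    rw [hg, Matrix.sub_mul, Matrix.smul_mul, Matrix.mul_assoc w, hba, Matrix.mul_assoc _ b a, hba]
  have h2 : a * gᴴ = (g * a)ᴴ := by rw [conjTranspose_mul, ha]
  have h3 : a * gᴴ = (1 - P) * w - (1 / 2 : ℂ) • ((1 - P) * w * (1 - P)) := by
    rw [h2, h1]
    simp [conjTranspose_sub, conjTranspose_smul, conjTranspose_mul, hP, hw, Matrix.mul_assoc]
  rw [h1, h3]
  have : w * (1 - P) + (1 - P) * w - (1 - P) * w * (1 - P) = w - P * w * P := by
    noncomm_ring
  rw [h, sub_zero] at this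
  refine Eq.trans ?_ this
  module

/-- The tangent cone (in the sense of Mathlib's `tangentConeAt`, over `ℝ`) of `C_{p,q}` at a
point `a ∈ C_{p,q}` is the real linear subspace of Hermitian matrices `w` such that
`⟨x, w y⟩ = 0` for all `x, y ∈ ℂʳ` in the kernel of `a`. -/
theorem tangentCone_Cpq {r : ℕ} (hr : 1 ≤ r) (p q : ℕ) (hpq : p + q ≤ r)
    (a : Matrix (Fin r) (Fin r) ℂ) (ha : a ∈ Cpq r p q) :
    tangentConeAt ℝ (Cpq r p q) a =
      {w : Matrix (Fin r) (Fin r) ℂ | w.IsHermitian ∧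
        ∀ x y : Fin r → ℂ, a.mulVec x = 0 → a.mulVec y = 0 → star x ⬝ᵥ w.mulVec y = 0} := by
  have haH : a.IsHermitian := ha.1
  obtain ⟨b, P, hb, hP, hab, hba, haP, hPb, hPP⟩ := exists_pinv haH
  ext w
  simp only [Set.mem_ofPred_eq]
  rw [proj_iff hP hba haP]
  constructor
  · intro hw
    obtain ⟨α, l, hl, c, d, hd0, hds, hcd⟩ := exists_fun_of_mem_tangentConeAt hw
    have hT0 : (a + P) * (b + P) = 1 := by
      simp only [Matrix.add_mul, Matrix.mul_add, hab, haP, hPb, hPP]; abel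
    have hu0 : IsUnit (a + P).det := by
      rw [← isUnit_iff_isUnit_det]
      exact IsUnit.of_mul_eq_one _ hT0
    have hPT : P * (a + P).adjugate = (a + P).det • P := by
      have e1 : P * (a + P) = P := by
        have : P * a = 0 := by
          have := congrArg conjTranspose haP
          simpa [conjTranspose_mul, hP, haH.eq] using this
        rw [Matrix.mul_add, this, hPP, zero_add]
      calc P * (a + P).adjugate = P * (a + P) * (a + P).adjugate := by rw [e1]
        _ = _ := by rw [Matrix.mul_assoc, mul_adjugate]; simp
    have hTlim : Tendsto (fun n => a + d n + P) l (𝓝 (a + P)) := by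
      have := (hd0.const_add a).add_const P
      simpa using this
    constructor
    · have hcl : IsClosed {x : Matrix (Fin r) (Fin r) ℂ | xᴴ = x} :=
        isClosed_eq (continuous_id.matrix_conjTranspose) continuous_id
      refine hcl.mem_of_tendsto hcd ?_
      filter_upwards [hds] with n hn
      have h1 : (a + d n)ᴴ = a + d n := hn.1
      rw [conjTranspose_add, haH.eq] at h1
      have h2 : (d n)ᴴ = d n := add_left_cancel h1
      show (c n • d n)ᴴ = c n • d n
      rw [conjTranspose_smul, h2]
      simp
    · have hF : Continuous fun z : Matrix (Fin r) (Fin r) ℂ × Matrix (Fin r) (Fin r) ℂ =>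
          P * z.1.adjugate * z.2 * P := by
        have := (continuous_fst (X := Matrix (Fin r) (Fin r) ℂ)
          (Y := Matrix (Fin r) (Fin r) ℂ)).matrix_adjugate
        fun_prop
      have hlim := (hF.tendsto (a + P, w)).comp (hTlim.prodMk_nhds hcd)
      have hev : ∀ᶠ n in l, P * (a + d n + P).adjugate * (c n • d n) * P = 0 := by
        have hdet : ∀ᶠ n in l, (a + d n + P).det ≠ 0 := by
          have hc : Continuous fun z : Matrix (Fin r) (Fin r) ℂ => z.det :=
            continuous_id.matrix_det
          exact ((hc.tendsto _).comp hTlim).eventually_ne hu0.ne_zero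
        filter_upwards [hds, hdet] with n hn hnd
        have := rank_key' (d := d n) hab haP hPb hPP hnd.isUnit
          (by rw [Cpq_rank hn, Cpq_rank ha])
        rw [Matrix.mul_smul, Matrix.smul_mul, this, smul_zero]
      have h0 : P * (a + P).adjugate * w * P = 0 := by
        refine tendsto_nhds_unique (hlim.congr' ?_) tendsto_const_nhds
        filter_upwards [hev] with n hn
        exact hn
      rw [hPT, Matrix.smul_mul, Matrix.smul_mul] at h0
      exact (smul_eq_zero.mp h0).resolve_left hu0.ne_zero
  · rintro ⟨hw, h⟩
    obtain ⟨g, hg⟩ := exists_gen haH.eq hP hba hw.eq h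
    refine mem_tangentConeAt_of_seq (𝓝[≠] (0 : ℝ)) (fun t => t⁻¹)
      (fun t => t • w + (t * t) • (g * a * gᴴ)) ?_ ?_ ?_
    · have : Continuous fun t : ℝ => t • w + (t * t) • (g * a * gᴴ) := by fun_prop
      have := (this.tendsto 0).mono_left (nhdsWithin_le_nhds (s := {0}ᶜ))
      simpa using this
    · have hc : Continuous fun t : ℝ => (1 + t • g).det := by
        apply Continuous.matrix_det
        fun_prop
      have hne : ∀ᶠ t in 𝓝 (0 : ℝ), (1 + t • g).det ≠ 0 :=
        (hc.tendsto 0).eventually_ne (by simp)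
      filter_upwards [hne.filter_mono nhdsWithin_le_nhds] with t ht
      convert Cpq_congr ha ht.isUnit using 1
      rw [← hg]
      simp only [conjTranspose_add, conjTranspose_one, conjTranspose_smul, star_trivial,
        Matrix.add_mul, Matrix.mul_add, Matrix.one_mul, Matrix.mul_one, Matrix.smul_mul,
        Matrix.mul_smul, smul_add, smul_smul, Matrix.mul_assoc]
      abel
    · have : Continuous fun t : ℝ => w + t • (g * a * gᴴ) := by fun_prop
      have := (this.tendsto 0).mono_left (nhdsWithin_le_nhds (s := {0}ᶜ))
      simp only [zero_smul, add_zero] at this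
      refine this.congr' ?_
      filter_upwards [self_mem_nhdsWithin] with t ht
      have ht : t ≠ 0 := ht
      rw [smul_add, smul_smul, smul_smul, inv_mul_cancel₀ ht, one_smul, ← mul_assoc,
        inv_mul_cancel₀ ht, one_mul]
end

section
/- Let r ≥ 2 and let a be a Hermitian r×r complex matrix with 0 < rank(a) < r. Let w = a u a for some Hermitian r×r matrix u. If a w v + v w a = 0 for every Hermitian r×r matrix v satisfying a v a = 0, then w = 0. -/
open Matrix
open scoped ComplexOrder

/-- Let `r ≥ 2` and let `a` be a Hermitian `r × r` complex matrix with `0 < rank a < r`.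
Let `w = a u a` for some Hermitian `u`. If `a w v + v w a = 0` for every Hermitian `v` with
`a v a = 0`, then `w = 0`.  (Nondegeneracy of the map `β` on Peirce spaces.) -/
theorem peirce_beta_nondegenerate {r : ℕ} (hr : 2 ≤ r)
    (a : Matrix (Fin r) (Fin r) ℂ) (ha : a.IsHermitian)
    (hrank_pos : 0 < a.rank) (hrank_lt : a.rank < r)
    (u : Matrix (Fin r) (Fin r) ℂ) (hu : u.IsHermitian)
    (w : Matrix (Fin r) (Fin r) ℂ) (hw : w = a * u * a)
    (h : ∀ v : Matrix (Fin r) (Fin r) ℂ, v.IsHermitian → a * v * a = 0 →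
      a * w * v + v * w * a = 0) :
    w = 0 := by
  have hdet : a.det = 0 := by
    by_contra hne
    have h1 : IsUnit a := (Matrix.isUnit_iff_isUnit_det a).2 (isUnit_iff_ne_zero.2 hne)
    have h2 := Matrix.rank_of_isUnit a h1
    simp at h2
    omega
  obtain ⟨k, hk0, hk⟩ := Matrix.exists_mulVec_eq_zero_iff.2 hdet
  have hka : star k ᵥ* a = 0 := by
    have h1 := congrArg star hk
    rw [Matrix.star_mulVec, ha.eq] at h1
    simpa using h1
  have hwk : w *ᵥ k = 0 := by
    rw [hw, ← Matrix.mulVec_mulVec, hk, Matrix.mulVec_zero]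
  have hkk : star k ⬝ᵥ k ≠ 0 := fun h0 => hk0 (dotProduct_star_self_eq_zero.1 h0)
  have key : ∀ x, (a * w) *ᵥ x = 0 := by
    intro x
    have h1 := h (vecMulVec x (star k) + vecMulVec k (star x))
      (by
        ext i j
        simp [vecMulVec_apply, mul_comm, add_comm])
      (by
        rw [Matrix.mul_add, Matrix.add_mul, Matrix.mul_vecMulVec, Matrix.mul_vecMulVec, hk,
          Matrix.vecMulVec_mul, hka]
        simp)
    have h2 := congrArg (fun m => m *ᵥ k) h1
    have h3 : (a * w) *ᵥ k = 0 := by rw [← Matrix.mulVec_mulVec, hwk, Matrix.mulVec_zero]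
    simp only [Matrix.add_mulVec, ← Matrix.mulVec_mulVec (M := a * w),
      ← Matrix.mulVec_mulVec (N := a), hk, Matrix.mulVec_zero, Matrix.zero_mulVec, add_zero,
      Matrix.vecMulVec_mulVec, Matrix.mulVec_add, op_smul_eq_smul, Matrix.mulVec_smul, h3,
      smul_zero] at h2
    exact (smul_eq_zero.1 h2).resolve_left hkk
  have haw : a * w = 0 := by
    apply Matrix.ext_of_mulVec_single
    intro i
    rw [key, Matrix.zero_mulVec]
  rw [hw, Matrix.mul_assoc] at haw ⊢
  have h5 : aᴴ * a * (u * a) = 0 := by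
    rw [ha.eq, Matrix.mul_assoc]; exact haw
  exact (Matrix.conjTranspose_mul_self_mul_eq_zero a (u * a)).1 h5
end

section
/- Let Sp(2,ℝ) = {A ∈ ℝ^{4×4} : Aᵀ J A = J} with J = [[0, I], [−I, 0]] in 2×2 blocks, and write A ∈ Sp(2,ℝ) in 2×2 block form A = [[a, b], [c, d]]. Let s be a real symmetric positive semidefinite 2×2 matrix of rank 1 (a point of the future light cone in the space of symmetric 2×2 matrices). Then for A ∈ Sp(2,ℝ) the following are equivalent: (i) the complex matrix c(is) + d is invertible and (a(is) + b)(c(is) + d)^{−1} = is; (ii) a s = s d and b = −s c s. In other words, the isotropy subgroup of Sp(2,ℝ) at the boundary point is of Siegel's upper half plane, for the action A(z) = (a z + b)(c z + d)^{−1}, consists exactly of those A satisfying the linear equations a s = s d and b = −s c s. -/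
open Matrix

/-- The standard symplectic form matrix `J = [[0, I], [−I, 0]]` in `2 × 2` blocks. -/
def sympJ : Matrix (Fin 2 ⊕ Fin 2) (Fin 2 ⊕ Fin 2) ℝ :=
  Matrix.fromBlocks 0 1 (-1) 0

/-- A complex matrix identity between real and imaginary parts splits. -/
theorem split_re_im (p q p' q' : Matrix (Fin 2) (Fin 2) ℝ)
    (h : Complex.I • p.map (Complex.ofReal ·) + q.map (Complex.ofReal ·) =
      Complex.I • p'.map (Complex.ofReal ·) + q'.map (Complex.ofReal ·)) : p = p' ∧ q = q' := by
  constructor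
  · ext i j
    have := congrArg Complex.im (congrFun (congrFun h i) j)
    simpa using this
  · ext i j
    have := congrArg Complex.re (congrFun (congrFun h i) j)
    simpa using this

theorem map_mul_ofReal (p q : Matrix (Fin 2) (Fin 2) ℝ) :
    (p * q).map (Complex.ofReal ·) = p.map (Complex.ofReal ·) * q.map (Complex.ofReal ·) :=
  (Complex.ofRealHom.mapMatrix (m := Fin 2)).map_mul p q

theorem map_neg_ofReal (p : Matrix (Fin 2) (Fin 2) ℝ) :
    (-p).map (Complex.ofReal ·) = -p.map (Complex.ofReal ·) :=
  (Complex.ofRealHom.mapMatrix (m := Fin 2)).map_neg p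

theorem map_sub_ofReal (p q : Matrix (Fin 2) (Fin 2) ℝ) :
    (p - q).map (Complex.ofReal ·) = p.map (Complex.ofReal ·) - q.map (Complex.ofReal ·) :=
  (Complex.ofRealHom.mapMatrix (m := Fin 2)).map_sub p q

theorem map_one_ofReal :
    (1 : Matrix (Fin 2) (Fin 2) ℝ).map (Complex.ofReal ·) = 1 :=
  (Complex.ofRealHom.mapMatrix (m := Fin 2)).map_one

/-- The fixed point equation, cleared of denominators, applied to `z = i s`. -/
theorem mul_expand (c d s : Matrix (Fin 2) (Fin 2) ℝ) :
    (Complex.I • s.map (Complex.ofReal ·)) *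
      (c.map (Complex.ofReal ·) * (Complex.I • s.map (Complex.ofReal ·)) +
        d.map (Complex.ofReal ·)) =
    Complex.I • (s * d).map (Complex.ofReal ·) + (-(s * c * s)).map (Complex.ofReal ·) := by
  rw [map_neg_ofReal, map_mul_ofReal, map_mul_ofReal, map_mul_ofReal, mul_add, add_comm]
  simp only [Matrix.smul_mul, Matrix.mul_smul, smul_smul, Complex.I_mul_I, neg_smul, one_smul,
    Matrix.mul_assoc]

/-- Let `A = [[a, b], [c, d]] ∈ Sp(2, ℝ)` and let `s` be a real symmetric positive semidefinite
`2 × 2` matrix of rank `1` (a point of the future light cone).  Then `A` fixes the boundary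
point `i·s` of Siegel's upper half plane under `A(z) = (az + b)(cz + d)⁻¹` (with `c·(is) + d`
invertible) if and only if `a s = s d` and `b = −s c s`. -/
theorem sp2_isotropy_at_lightcone_point (a b c d s : Matrix (Fin 2) (Fin 2) ℝ)
    (hA : (Matrix.fromBlocks a b c d)ᵀ * sympJ * Matrix.fromBlocks a b c d = sympJ)
    (hsymm : s.IsSymm) (hpsd : s.PosSemidef) (hrank : s.rank = 1) :
    (IsUnit (c.map (Complex.ofReal ·) * (Complex.I • s.map (Complex.ofReal ·)) +
        d.map (Complex.ofReal ·)) ∧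
      (a.map (Complex.ofReal ·) * (Complex.I • s.map (Complex.ofReal ·)) +
          b.map (Complex.ofReal ·)) *
        (c.map (Complex.ofReal ·) * (Complex.I • s.map (Complex.ofReal ·)) +
          d.map (Complex.ofReal ·))⁻¹ =
        Complex.I • s.map (Complex.ofReal ·)) ↔
      (a * s = s * d ∧ b = -(s * c * s)) := by
  have hb : aᵀ * c - cᵀ * a = 0 ∧ aᵀ * d - cᵀ * b = 1 := by
    rw [sympJ, Matrix.fromBlocks_transpose, Matrix.fromBlocks_multiply,
      Matrix.fromBlocks_multiply, Matrix.fromBlocks_inj] at hA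
    obtain ⟨h1, h2, -, -⟩ := hA
    simp only [mul_zero, mul_one, mul_neg, neg_mul, zero_add, add_zero] at h1 h2
    constructor
    · rw [← h1]; abel
    · rw [← h2]; abel
  have key := mul_expand c d s
  have hl : a.map (Complex.ofReal ·) * (Complex.I • s.map (Complex.ofReal ·)) +
      b.map (Complex.ofReal ·) =
      Complex.I • (a * s).map (Complex.ofReal ·) + b.map (Complex.ofReal ·) := by
    rw [map_mul_ofReal, Matrix.mul_smul]
  constructor
  · rintro ⟨hu, he⟩
    have hdet := (Matrix.isUnit_iff_isUnit_det _).1 hu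
    have h3 := congrArg (· * (c.map (Complex.ofReal ·) * (Complex.I • s.map (Complex.ofReal ·)) +
        d.map (Complex.ofReal ·))) he
    simp only [] at h3
    rw [Matrix.nonsing_inv_mul_cancel_right _ _ hdet, key, hl] at h3
    exact split_re_im _ _ _ _ h3
  · rintro ⟨h1, h2⟩
    have hz : a.map (Complex.ofReal ·) * (Complex.I • s.map (Complex.ofReal ·)) +
        b.map (Complex.ofReal ·) = (Complex.I • s.map (Complex.ofReal ·)) *
      (c.map (Complex.ofReal ·) * (Complex.I • s.map (Complex.ofReal ·)) +
        d.map (Complex.ofReal ·)) := by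
      rw [key, hl, h1, ← h2]
    have e1 := congrArg (fun m : Matrix (Fin 2) (Fin 2) ℝ => m.map (Complex.ofReal ·)) hb.1
    have e2 := congrArg (fun m : Matrix (Fin 2) (Fin 2) ℝ => m.map (Complex.ofReal ·)) hb.2
    have e0 : (0 : Matrix (Fin 2) (Fin 2) ℝ).map (Complex.ofReal ·) = 0 :=
      (Complex.ofRealHom.mapMatrix (m := Fin 2)).map_zero
    simp only [map_sub_ofReal, map_mul_ofReal, map_one_ofReal, e0] at e1 e2
    clear hl key
    generalize Complex.I • s.map (Complex.ofReal ·) = z at *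
    generalize a.map (Complex.ofReal ·) = a' at *
    generalize b.map (Complex.ofReal ·) = b' at *
    generalize c.map (Complex.ofReal ·) = c' at *
    generalize d.map (Complex.ofReal ·) = d' at *
    generalize aᵀ.map (Complex.ofReal ·) = ta' at *
    generalize cᵀ.map (Complex.ofReal ·) = ct' at *
    have hinv : (ta' - ct' * z) * (c' * z + d') = 1 := by
      calc (ta' - ct' * z) * (c' * z + d')
          = ta' * (c' * z + d') - ct' * (z * (c' * z + d')) := by noncomm_ring
        _ = ta' * (c' * z + d') - ct' * (a' * z + b') := by rw [hz]
        _ = (ta' * c' - ct' * a') * z + (ta' * d' - ct' * b') := by noncomm_ring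
        _ = 1 := by rw [e1, e2, zero_mul, zero_add]
    have hdet : IsUnit (c' * z + d').det := Matrix.isUnit_det_of_left_inverse hinv
    refine ⟨(Matrix.isUnit_iff_isUnit_det _).2 hdet, ?_⟩
    rw [hz, Matrix.mul_nonsing_inv_cancel_right _ _ hdet]
end
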